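/- Let X be a metric space and n ≥ 1 an integer. Then X admits a bi-Lipschitz embedding into some Euclidean space ℝ^m (for some m) if and only if the n-th symmetric product X^(n) admits a bi-Lipschitz embedding into some Euclidean space ℝ^m' (for some m'). -/

import Mathlib

open Metric

namespace SymProd
open TopologicalSpace

theorem ext_real {Y : Type*} [MetricSpace Y] (E : Set Y) (φ : Y → ℝ) (L : ℝ) (hL : 0 ≤ L)
    (h : ∀ A ∈ E, ∀ B ∈ E, |φ A - φ B| ≤ L * dist A B) :
    ∃ g : Y → ℝ, (∀ A B, |g A - g B| ≤ L * dist A B) ∧ ∀ A ∈ E, g A = φ A := by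
  have h1 : LipschitzOnWith ⟨L, hL⟩ φ E :=
    LipschitzOnWith.of_dist_le_mul fun x hx y hy => by
      rw [Real.dist_eq]; exact h x hx y hy
  obtain ⟨g, hg, he⟩ := h1.extend_real
  refine ⟨g, fun A B => ?_, fun A hA => (he hA).symm⟩
  have := hg.dist_le_mul A B
  rwa [Real.dist_eq] at this

theorem haus_exists {X : Type*} [MetricSpace X] {A B : Set X} (hA : A.Finite) (hB : B.Finite)
    (hA' : A.Nonempty) (hB' : B.Nonempty) {x : X} (hx : x ∈ A) :
    ∃ y ∈ B, dist x y ≤ hausdorffDist A B := by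
  obtain ⟨y, hy, h⟩ := hB.isCompact.exists_infDist_eq_dist hB' x
  refine ⟨y, hy, h ▸ infDist_le_hausdorffDist_of_mem hx ?_⟩
  exact hausdorffEDist_ne_top_of_nonempty_of_bounded hA' hB' hA.isBounded hB.isBounded

/-- `K` is the range of a monotone `n`-tuple. -/
def Rep (n : ℕ) (K : NonemptyCompacts ℝ) (a : Fin n → ℝ) : Prop :=
  Monotone a ∧ Set.range a = (K : Set ℝ)

theorem Rep.close {n m : ℕ} {K K' : NonemptyCompacts ℝ} {a : Fin n → ℝ} {b : Fin m → ℝ}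
    (ha : Rep n K a) (hb : Rep m K' b) (k : Fin n) : ∃ j, |a k - b j| ≤ dist K K' := by
  rw [NonemptyCompacts.dist_eq]
  have h1 : (K : Set ℝ).Finite := ha.2 ▸ Set.finite_range a
  have h2 : (K' : Set ℝ).Finite := hb.2 ▸ Set.finite_range b
  obtain ⟨y, hy, h⟩ := haus_exists h1 h2 K.nonempty K'.nonempty (x := a k)
    (ha.2 ▸ Set.mem_range_self k)
  rw [← hb.2] at hy
  obtain ⟨j, rfl⟩ := hy
  exact ⟨j, h⟩

theorem Rep.dist_le {n m : ℕ} {K K' : NonemptyCompacts ℝ} {a : Fin n → ℝ} {b : Fin m → ℝ}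
    (ha : Rep n K a) (hb : Rep m K' b) (r : ℝ) (hr : 0 ≤ r) (h1 : ∀ k, ∃ j, |a k - b j| ≤ r)
    (h2 : ∀ k, ∃ j, |b k - a j| ≤ r) : dist K K' ≤ r := by
  rw [NonemptyCompacts.dist_eq, ← ha.2, ← hb.2]
  apply hausdorffDist_le_of_mem_dist hr
  · rintro _ ⟨k, rfl⟩
    obtain ⟨j, hj⟩ := h1 k
    exact ⟨b j, ⟨j, rfl⟩, hj⟩
  · rintro _ ⟨k, rfl⟩
    obtain ⟨j, hj⟩ := h2 k
    exact ⟨a j, ⟨j, rfl⟩, hj⟩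

theorem match_sorted {n : ℕ} {a b : Fin n → ℝ} (hb : Monotone b) (r : ℝ)
    (hg : ∀ k l, k < l → 2 * r < a l - a k) (h : ∀ k, ∃ j, |a k - b j| ≤ r) (k : Fin n) :
    |a k - b k| ≤ r := by
  choose σ hσ using h
  have hs : StrictMono σ := by
    intro k l hkl
    by_contra hc
    have h1 := hb (not_lt.1 hc)
    have h2 := hg k l hkl
    have h3 := abs_le.1 (hσ k)
    have h4 := abs_le.1 (hσ l)
    linarith
  have : σ k = k := le_antisymm hs.apply_le hs.le_apply
  simpa [this] using hσ k

/-- Minimal gap. -/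
noncomputable def gap {n : ℕ} (a : Fin (n + 2) → ℝ) : ℝ :=
  Finset.univ.inf' ⟨0, Finset.mem_univ _⟩ fun i : Fin (n + 1) => a i.succ - a i.castSucc

theorem gap_le {n : ℕ} (a : Fin (n + 2) → ℝ) (i : Fin (n + 1)) :
    gap a ≤ a i.succ - a i.castSucc := Finset.inf'_le _ (Finset.mem_univ i)

theorem le_gap {n : ℕ} (a : Fin (n + 2) → ℝ) (c : ℝ)
    (h : ∀ i : Fin (n + 1), c ≤ a i.succ - a i.castSucc) : c ≤ gap a :=
  Finset.le_inf' _ _ fun _ _ => h _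

theorem exists_gap {n : ℕ} (a : Fin (n + 2) → ℝ) :
    ∃ i : Fin (n + 1), gap a = a i.succ - a i.castSucc := by
  obtain ⟨i, _, h⟩ := Finset.exists_mem_eq_inf' (s := Finset.univ) ⟨0, Finset.mem_univ _⟩
    fun i : Fin (n + 1) => a i.succ - a i.castSucc
  exact ⟨i, h⟩

theorem gap_nonneg {n : ℕ} {a : Fin (n + 2) → ℝ} (ha : Monotone a) : 0 ≤ gap a :=
  le_gap _ _ fun i => sub_nonneg.2 (ha (Fin.castSucc_lt_succ).le)

theorem gap_le_of_lt {n : ℕ} {a : Fin (n + 2) → ℝ} (ha : Monotone a) (k l : Fin (n + 2))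
    (h : k < l) : gap a ≤ a l - a k := by
  obtain ⟨i, rfl⟩ : ∃ i : Fin (n + 1), i.castSucc = k :=
    ⟨⟨k.1, by have := l.2; have : k.1 < l.1 := h; omega⟩, rfl⟩
  have h1 := gap_le a i
  have h2 : a i.succ ≤ a l := ha (Fin.castSucc_lt_iff_succ_le.1 h)
  linarith

theorem Rep.match {n : ℕ} {K K' : NonemptyCompacts ℝ} {a b : Fin (n + 2) → ℝ}
    (ha : Rep (n + 2) K a) (hb : Rep (n + 2) K' b) (h : 2 * dist K K' < gap a)
    (k : Fin (n + 2)) : |a k - b k| ≤ dist K K' :=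
  match_sorted hb.1 _ (fun k l hkl => h.trans_le (gap_le_of_lt ha.1 k l hkl)) (ha.close hb) k

theorem gap_lip1 {n : ℕ} {K K' : NonemptyCompacts ℝ} {a b : Fin (n + 2) → ℝ}
    (ha : Rep (n + 2) K a) (hb : Rep (n + 2) K' b) : gap a - gap b ≤ 2 * dist K K' := by
  by_cases h : 2 * dist K K' < gap a
  · have := ha.match hb h
    have : gap a - 2 * dist K K' ≤ gap b := by
      apply le_gap
      intro i
      have h1 := gap_le a i
      have h2 := abs_le.1 (this i.succ)
      have h3 := abs_le.1 (this i.castSucc)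
      linarith
    linarith
  · have := gap_nonneg hb.1
    linarith

theorem gap_lip {n : ℕ} {K K' : NonemptyCompacts ℝ} {a b : Fin (n + 2) → ℝ}
    (ha : Rep (n + 2) K a) (hb : Rep (n + 2) K' b) : |gap a - gap b| ≤ 2 * dist K K' := by
  rw [abs_le]
  have h1 := gap_lip1 ha hb
  have h2 := gap_lip1 hb ha
  rw [dist_comm] at h2
  constructor <;> linarith

/-- Removing a point. -/
theorem exists_smaller {n : ℕ} {K : NonemptyCompacts ℝ} {a : Fin (n + 2) → ℝ}
    (ha : Rep (n + 2) K a) : ∃ K' a', Rep (n + 1) K' a' ∧ dist K K' ≤ gap a := by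
  obtain ⟨i, hi⟩ := exists_gap a
  let a' : Fin (n + 1) → ℝ := a ∘ i.castSucc.succAbove
  let K' : NonemptyCompacts ℝ := ⟨⟨Set.range a', (Set.finite_range a').isCompact⟩,
    Set.range_nonempty a'⟩
  have ha' : Rep (n + 1) K' a' := ⟨ha.1.comp (Fin.strictMono_succAbove _).monotone, rfl⟩
  refine ⟨K', a', ha', ha.dist_le ha' _ (gap_nonneg ha.1) ?_ ?_⟩
  · intro k
    by_cases hk : k = i.castSucc
    · subst hk
      refine ⟨i, ?_⟩
      have : a' i = a i.succ := by simp [a']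
      rw [this, abs_sub_comm, ← hi, abs_of_nonneg (gap_nonneg ha.1)]
    · obtain ⟨j, hj⟩ := Fin.exists_succAbove_eq hk
      refine ⟨j, ?_⟩
      simp [a', hj, gap_nonneg ha.1]
  · intro k
    exact ⟨i.castSucc.succAbove k, by simp [a', gap_nonneg ha.1]⟩

theorem trig_sep {x y η : ℝ} (hxy : |x - y| ≤ 1) (hs : |Real.sin x - Real.sin y| ≤ η)
    (hc : |Real.cos x - Real.cos y| ≤ η) : |x - y| ≤ 3 * η := by
  have hη : 0 ≤ η := (abs_nonneg _).trans hs
  have h1 := Real.cos_le_one_sub_mul_cos_sq (x := x - y) (by linarith [Real.pi_gt_three])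
  rw [Real.cos_sub] at h1
  have h2 : (Real.sin x - Real.sin y) ^ 2 ≤ η ^ 2 := sq_le_sq' (abs_le.1 hs).1 (abs_le.1 hs).2
  have h3 : (Real.cos x - Real.cos y) ^ 2 ≤ η ^ 2 := sq_le_sq' (abs_le.1 hc).1 (abs_le.1 hc).2
  have h4 := Real.sin_sq_add_cos_sq x
  have h5 := Real.sin_sq_add_cos_sq y
  have h6 : 2 / Real.pi ^ 2 * (x - y) ^ 2 ≤ η ^ 2 := by nlinarith
  have h7 : (2 : ℝ) / 18 ≤ 2 / Real.pi ^ 2 := by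
    apply div_le_div_of_nonneg_left (by norm_num) (by positivity)
    nlinarith [Real.pi_lt_d2, Real.pi_gt_three]
  have h8 : (2 : ℝ) / 18 * (x - y) ^ 2 ≤ η ^ 2 :=
    (mul_le_mul_of_nonneg_right h7 (sq_nonneg _)).trans h6
  apply abs_le_of_sq_le_sq _ (by positivity)
  nlinarith

theorem trig_sep' {x y η R : ℝ} (hR : 1 ≤ R) (hxy : |x - y| ≤ R)
    (hs : |Real.sin (x / R) - Real.sin (y / R)| ≤ η)
    (hc : |Real.cos (x / R) - Real.cos (y / R)| ≤ η) : |x - y| ≤ 3 * R * η := by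
  have hR0 : 0 < R := by linarith
  have e : |x / R - y / R| = |x - y| / R := by rw [← sub_div, abs_div, abs_of_pos hR0]
  have := trig_sep (by rw [e]; exact (div_le_one hR0).2 hxy) hs hc
  rw [e, div_le_iff₀ hR0] at this
  linarith

/-- The separating functions at unit scale. -/
noncomputable def H {n : ℕ} (R : ℝ) :
    (Fin (n + 2) ⊕ Fin (n + 2) ⊕ Fin (n + 1)) → (Fin (n + 2) → ℝ) → ℝ
  | .inl k, a => Real.sin (a k / R)
  | .inr (.inl k), a => Real.cos (a k / R)
  | .inr (.inr k), a => min |a k.succ - a k.castSucc| (R + 3)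

theorem H_bdd {n : ℕ} {R : ℝ} (hR : 1 ≤ R) (i) (a : Fin (n + 2) → ℝ) : |H R i a| ≤ R + 3 := by
  rcases i with k | k | k
  · exact (Real.abs_sin_le_one _).trans (by linarith)
  · exact (Real.abs_cos_le_one _).trans (by linarith)
  · simp only [H]
    rw [abs_of_nonneg (le_min (abs_nonneg _) (by linarith))]
    exact min_le_right _ _

theorem abs_min_sub (x y c : ℝ) : |min x c - min y c| ≤ |x - y| := by
  simpa using abs_min_sub_min_le_max x c y c

theorem H_lip {n : ℕ} {R : ℝ} (hR : 1 ≤ R) (i) (a b : Fin (n + 2) → ℝ) (r : ℝ)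
    (h : ∀ k, |a k - b k| ≤ r) : |H R i a - H R i b| ≤ 2 * r := by
  have hR0 : 0 < R := by linarith
  have hr : 0 ≤ r := (abs_nonneg _).trans (h 0)
  have e : ∀ k, |a k / R - b k / R| ≤ 2 * r := by
    intro k
    rw [← sub_div, abs_div, abs_of_pos hR0, div_le_iff₀ hR0]
    nlinarith [h k]
  rcases i with k | k | k
  · exact (Real.abs_sin_sub_sin_le _ _).trans (e k)
  · exact (Real.abs_cos_sub_cos_le _ _).trans (e k)
  · simp only [H]
    refine (abs_min_sub _ _ _).trans ((abs_abs_sub_abs_le _ _).trans ?_)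
    have h2 := abs_le.1 (h k.succ)
    have h3 := abs_le.1 (h k.castSucc)
    rw [abs_le]; constructor <;> linarith

theorem H_sep_aux {n : ℕ} {R : ℝ} (hR : 1 ≤ R) {a b : Fin (n + 2) → ℝ} (ha : Monotone a)
    (hb : Monotone b) (h1 : ∀ k, ∃ j, |a k - b j| ≤ R) (h2 : ∀ k, ∃ j, |b k - a j| ≤ R)
    (η : ℝ) (hη : (3 * R + (n + 2)) * η ≤ 1) (h : ∀ i, |H R i a - H R i b| ≤ η) :
    ∀ k : Fin (n + 2), |a k - b k| ≤ (3 * R + k.1) * η := by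
  have hη0 : 0 ≤ η := (abs_nonneg _).trans (h (.inl 0))
  have trig : ∀ k, |a k - b k| ≤ R → |a k - b k| ≤ 3 * R * η := fun k hk =>
    trig_sep' hR hk (h (.inl k)) (h (.inr (.inl k)))
  have half : ∀ (a b : Fin (n + 2) → ℝ), Monotone b → (∀ k, ∃ j, |a k - b j| ≤ R) →
      ∀ k : Fin (n + 1), b k.castSucc + R < a k.succ → b k.succ ≤ a k.succ + R := by
    intro a b hb h1 k hk
    obtain ⟨j, hj⟩ := h1 k.succ
    have hj := abs_le.1 hj
    have : k.castSucc < j := by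
      by_contra hc
      have := hb (not_lt.1 hc)
      linarith
    have := hb (Fin.castSucc_lt_iff_succ_le.1 this)
    linarith
  intro k
  induction k using Fin.induction with
  | zero =>
    simp only [Fin.val_zero, Nat.cast_zero, add_zero]
    apply trig
    obtain ⟨j, hj⟩ := h1 0
    obtain ⟨l, hl⟩ := h2 0
    have hj := abs_le.1 hj
    have hl := abs_le.1 hl
    have := hb (Fin.zero_le j)
    have := ha (Fin.zero_le l)
    rw [abs_le]; constructor <;> linarith
  | succ k ih =>
    have hg := h (.inr (.inr k))
    simp only [H] at hg
    have ga : 0 ≤ a k.succ - a k.castSucc := sub_nonneg.2 (ha (Fin.castSucc_lt_succ).le)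
    have gb : 0 ≤ b k.succ - b k.castSucc := sub_nonneg.2 (hb (Fin.castSucc_lt_succ).le)
    rw [abs_of_nonneg ga, abs_of_nonneg gb] at hg
    have hkn : (k.1 : ℝ) ≤ n := by exact_mod_cast Nat.lt_succ_iff.1 k.2
    have hk0 : (0 : ℝ) ≤ k.1 := by positivity
    have hsmall : (3 * R + k.1) * η + η ≤ 1 := by nlinarith
    simp only [Fin.val_castSucc] at ih
    have ih' := abs_le.1 ih
    have hg' := abs_le.1 hg
    simp only [Fin.val_succ, Nat.cast_add, Nat.cast_one]
    have hle : 3 * R * η ≤ (3 * R + (k.1 + 1)) * η := by nlinarith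
    have h3 : 0 ≤ 3 * R * η := by positivity
    by_cases hc : a k.succ - a k.castSucc < R + 3 ∧ b k.succ - b k.castSucc < R + 3
    · rw [min_eq_left hc.1.le, min_eq_left hc.2.le] at hg'
      rw [abs_le]; constructor <;> linarith
    · have : R + 3 - η ≤ a k.succ - a k.castSucc ∧ R + 3 - η ≤ b k.succ - b k.castSucc := by
        have m1 := min_le_left (a k.succ - a k.castSucc) (R + 3)
        have m2 := min_le_left (b k.succ - b k.castSucc) (R + 3)
        by_cases hc1 : a k.succ - a k.castSucc < R + 3
        · have hc2 : R + 3 ≤ b k.succ - b k.castSucc := by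
            by_contra h5; exact hc ⟨hc1, not_le.1 h5⟩
          rw [min_eq_right hc2] at hg'
          constructor <;> linarith
        · have hc1 := not_lt.1 hc1
          rw [min_eq_right hc1] at hg'
          constructor <;> linarith
      refine (trig _ ?_).trans hle
      have k0 : 0 ≤ k.1 * η := by positivity
      have p1 := half a b hb h1 k (by linarith)
      have p2 := half b a ha h2 k (by linarith)
      rw [abs_le]; constructor <;> linarith

theorem H_sep {n : ℕ} {R : ℝ} (hR : 1 ≤ R) {a b : Fin (n + 2) → ℝ} (ha : Monotone a)
    (hb : Monotone b) (h1 : ∀ k, ∃ j, |a k - b j| ≤ R) (h2 : ∀ k, ∃ j, |b k - a j| ≤ R) :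
    ∃ i, 1 ≤ (3 * R + (n + 2)) * |H R i a - H R i b| ∨
      ∀ k, |a k - b k| ≤ (3 * R + (n + 2)) * |H R i a - H R i b| := by
  obtain ⟨i, hi⟩ := Finite.exists_max fun i => |H R i a - H R i b|
  refine ⟨i, ?_⟩
  by_cases h : 1 ≤ (3 * R + (n + 2)) * |H R i a - H R i b|
  · exact Or.inl h
  · right
    intro k
    refine (H_sep_aux hR ha hb h1 h2 _ (not_le.1 h).le hi k).trans ?_
    apply mul_le_mul_of_nonneg_right _ (abs_nonneg _)
    have : (k.1 : ℝ) ≤ (n + 2 : ℕ) := by exact_mod_cast k.2.le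
    push_cast at this
    linarith


theorem bin_sep {x y : ℝ} {j j' p : ℤ} (hj : j < j') (hx : x < 2 ^ (3 * j + p + 2))
    (hy : (2 : ℝ) ^ (3 * j' + p) ≤ y) : 2 * x < y := by
  have h1 : (2 : ℝ) ^ (3 * j + p + 2) * 2 ≤ 2 ^ (3 * j' + p) := by
    rw [← zpow_add_one₀ (by norm_num)]
    exact zpow_le_zpow_right₀ (by norm_num) (by omega)
  linarith

/-- Gluing the separating functions over scales. -/
theorem exists_bin {n : ℕ} {R : ℝ} (hR : 1 ≤ R) (seq : NonemptyCompacts ℝ → Fin (n + 2) → ℝ)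
    (S : Set (NonemptyCompacts ℝ)) (hS : ∀ K ∈ S, Rep (n + 2) K (seq K)) (p : ℤ) (i) :
    ∃ Φ : NonemptyCompacts ℝ → ℝ, (∃ L, ∀ A B, |Φ A - Φ B| ≤ L * dist A B) ∧
      ∀ K ∈ S, ∀ j : ℤ, (2 : ℝ) ^ (3 * j + p) ≤ gap (seq K) → gap (seq K) < 2 ^ (3 * j + p + 2) →
        Φ K = 2 ^ (3 * j + p) * H R i (((2 : ℝ) ^ (3 * j + p))⁻¹ • seq K) := by
  classical
  let P : NonemptyCompacts ℝ → ℤ → Prop := fun K j =>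
    (2 : ℝ) ^ (3 * j + p) ≤ gap (seq K) ∧ gap (seq K) < 2 ^ (3 * j + p + 2)
  let E : Set (NonemptyCompacts ℝ) := {K | K ∈ S ∧ ∃ j, P K j}
  have hE : ∀ K ∈ E, ∃ j, P K j := fun K hK => hK.2
  choose! J hJ using hE
  have huniq : ∀ K ∈ E, ∀ j, P K j → j = J K := by
    intro K hK j hj
    have hg := gap_nonneg (hS K hK.1).1
    rcases lt_trichotomy j (J K) with h | h | h
    · have := bin_sep h hj.2 (hJ K hK).1; linarith
    · exact h
    · have := bin_sep h (hJ K hK).2 hj.1; linarith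
  let φ : NonemptyCompacts ℝ → ℝ := fun K =>
    2 ^ (3 * J K + p) * H R i (((2 : ℝ) ^ (3 * J K + p))⁻¹ • seq K)
  have bdd : ∀ K ∈ E, |φ K| ≤ gap (seq K) * (R + 3) := by
    intro K hK
    have h0 : (0 : ℝ) < 2 ^ (3 * J K + p) := by positivity
    simp only [φ]
    rw [abs_mul, abs_of_pos h0]
    exact mul_le_mul (hJ K hK).1 (H_bdd hR _ _) (abs_nonneg _) (gap_nonneg (hS K hK.1).1)
  have key1 : ∀ A ∈ E, ∀ B ∈ E, J A < J B → |φ A - φ B| ≤ 8 * (R + 3) * dist A B := by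
    intro A hA B hB hlt
    have h1 := bin_sep hlt (hJ A hA).2 (hJ B hB).1
    have h2 := gap_lip1 (hS B hB.1) (hS A hA.1)
    rw [dist_comm] at h2
    have h3 := (abs_sub (φ A) (φ B)).trans (add_le_add (bdd A hA) (bdd B hB))
    have h4 : gap (seq A) + gap (seq B) ≤ 8 * dist A B := by
      have : 0 ≤ dist A B := dist_nonneg
      linarith
    have h5 : (gap (seq A) + gap (seq B)) * (R + 3) ≤ 8 * dist A B * (R + 3) :=
      mul_le_mul_of_nonneg_right h4 (by linarith)
    linarith
  have key2 : ∀ A ∈ E, ∀ B ∈ E, J A = J B → |φ A - φ B| ≤ 8 * (R + 3) * dist A B := by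
    intro A hA B hB heq
    have hd : 0 ≤ dist A B := dist_nonneg
    have h0 : (0 : ℝ) < 2 ^ (3 * J A + p) := by positivity
    have gA := (hJ A hA).1
    simp only [φ]
    rw [← heq]
    set s : ℝ := 2 ^ (3 * J A + p) with hs
    rw [← mul_sub, abs_mul, abs_of_pos h0]
    by_cases hc : 2 * dist A B < gap (seq A)
    · have hm := (hS A hA.1).match (hS B hB.1) hc
      have : |H R i (s⁻¹ • seq A) - H R i (s⁻¹ • seq B)| ≤ 2 * (s⁻¹ * dist A B) := by
        apply H_lip hR
        intro k
        simp only [Pi.smul_apply, smul_eq_mul]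
        rw [← mul_sub, abs_mul, abs_of_pos (inv_pos.2 h0)]
        exact mul_le_mul_of_nonneg_left (hm k) (inv_pos.2 h0).le
      calc _ ≤ s * (2 * (s⁻¹ * dist A B)) := mul_le_mul_of_nonneg_left this h0.le
        _ = 2 * dist A B := by field_simp
        _ ≤ _ := by nlinarith
    · have h1 : s ≤ 2 * dist A B := by linarith
      have h3 := (abs_sub (H R i (s⁻¹ • seq A)) (H R i (s⁻¹ • seq B))).trans
        (add_le_add (H_bdd hR i _) (H_bdd hR i _))
      calc _ ≤ (2 * dist A B) * (R + 3 + (R + 3)) := 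
            mul_le_mul h1 h3 (abs_nonneg _) (by linarith)
        _ ≤ _ := by nlinarith
  obtain ⟨Φ, hΦ, hΦE⟩ := ext_real E φ (8 * (R + 3)) (by linarith) (by
    intro A hA B hB
    rcases lt_trichotomy (J A) (J B) with h | h | h
    · exact key1 A hA B hB h
    · exact key2 A hA B hB h
    · rw [abs_sub_comm, dist_comm]; exact key1 B hB A hA h)
  refine ⟨Φ, ⟨_, hΦ⟩, ?_⟩
  intro K hK j h1 h2
  have hKE : K ∈ E := ⟨hK, j, h1, h2⟩
  rw [hΦE K hKE, huniq K hKE j ⟨h1, h2⟩]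

/-- `S` is separated by finitely many Lipschitz functions. -/
def Good (n : ℕ) : Prop :=
  ∃ F : Set (NonemptyCompacts ℝ → ℝ), F.Finite ∧
    (∀ f ∈ F, ∃ L, ∀ A B, |f A - f B| ≤ L * dist A B) ∧
    ∃ C, 0 ≤ C ∧ ∀ A B, (∃ a, Rep n A a) → (∃ b, Rep n B b) → ∃ f ∈ F, dist A B ≤ C * |f A - f B|

theorem unif {Y : Type*} [MetricSpace Y] {F : Set (Y → ℝ)} (hF : F.Finite)
    (h : ∀ f ∈ F, ∃ L : ℝ, ∀ A B, |f A - f B| ≤ L * dist A B) :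
    ∃ L : ℝ, 0 ≤ L ∧ ∀ f ∈ F, ∀ A B, |f A - f B| ≤ L * dist A B := by
  choose! L hL using h
  obtain ⟨M, hM⟩ := (hF.image L).bddAbove
  refine ⟨max M 0, le_max_right _ _, fun f hf A B => (hL f hf A B).trans ?_⟩
  exact mul_le_mul_of_nonneg_right ((hM ⟨f, hf, rfl⟩).trans (le_max_left _ _)) dist_nonneg

theorem good_one : Good 1 := by
  let S : Set (NonemptyCompacts ℝ) := {K | ∃ a, Rep 1 K a}
  have hS : ∀ K ∈ S, ∃ a, Rep 1 K a := fun K hK => hK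
  choose! seq hseq using hS
  have h : ∀ A ∈ S, ∀ B ∈ S, |seq A 0 - seq B 0| ≤ 1 * dist A B := by
    intro A hA B hB
    obtain ⟨j, hj⟩ := (hseq A hA).close (hseq B hB) 0
    rw [Subsingleton.elim j 0] at hj
    linarith
  obtain ⟨g, hg, hgE⟩ := ext_real S (fun K => seq K 0) 1 zero_le_one h
  refine ⟨{g}, Set.finite_singleton _, ?_, 1, zero_le_one, ?_⟩
  · rintro _ rfl; exact ⟨1, hg⟩
  · intro A B hA hB
    refine ⟨g, rfl, ?_⟩
    rw [hgE A hA, hgE B hB, one_mul]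
    refine (hseq A hA).dist_le (hseq B hB) _ (abs_nonneg _) (fun k => ⟨0, ?_⟩) (fun k => ⟨0, ?_⟩)
    · rw [Subsingleton.elim k 0]
    · rw [Subsingleton.elim k 0, abs_sub_comm]

theorem good_step (n : ℕ) (h : Good (n + 1)) : Good (n + 2) := by
  obtain ⟨F, hF, hFL, C0, hC0, hsep⟩ := h
  obtain ⟨L0, hL0, hL⟩ := unif hF hFL
  let S : Set (NonemptyCompacts ℝ) := {K | ∃ a, Rep (n + 2) K a}
  have hS : ∀ K ∈ S, ∃ a, Rep (n + 2) K a := fun K hK => hK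
  choose! seq hseq using hS
  obtain ⟨δ, hδ, hδE⟩ := ext_real S (fun K => gap (seq K)) 2 zero_le_two
    (fun A hA B hB => gap_lip (hseq A hA) (hseq B hB))
  set C : ℝ := 2 * (2 + 2 * C0 * L0) with hC
  have hC4 : 4 ≤ C := by have : 0 ≤ C0 * L0 := by positivity
                         linarith
  set R : ℝ := 4 * C with hRdef
  have hR : 1 ≤ R := by linarith
  choose Φ hΦ hΦE using fun (p : Fin 3) i => exists_bin (n := n) hR seq S hseq (p.1 : ℤ) i
  set D : ℝ := 3 * R + (n + 2) with hD
  have hD0 : 0 ≤ D := by positivity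
  refine ⟨F ∪ {δ} ∪ Set.range fun q : Fin 3 × _ => Φ q.1 q.2, ?_, ?_, 2 * C0 + 2 * C + R * D, ?_, ?_⟩
  · exact (hF.union (Set.finite_singleton _)).union (Set.finite_range _)
  · rintro f ((hf | rfl) | ⟨q, rfl⟩)
    · exact hFL f hf
    · exact ⟨2, hδ⟩
    · exact hΦ q.1 q.2
  · positivity
  · have main : ∀ A ∈ S, ∀ B ∈ S, gap (seq A) ≤ gap (seq B) →
        ∃ f ∈ F ∪ {δ} ∪ Set.range fun q : Fin 3 × _ => Φ q.1 q.2,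
          dist A B ≤ (2 * C0 + 2 * C + R * D) * |f A - f B| := by
      intro A hA B hB hAB
      have gA := gap_nonneg (hseq A hA).1
      have gB := gap_nonneg (hseq B hB).1
      have hRD : 0 ≤ R * D := by positivity
      by_cases c1 : C * gap (seq B) < dist A B
      · obtain ⟨A', a', hA', dA⟩ := exists_smaller (hseq A hA)
        obtain ⟨B', b', hB', dB⟩ := exists_smaller (hseq B hB)
        obtain ⟨f, hf, hfs⟩ := hsep A' B' ⟨a', hA'⟩ ⟨b', hB'⟩
        refine ⟨f, Or.inl (Or.inl hf), ?_⟩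
        have l1 := hL f hf A A'
        have l2 := hL f hf B B'
        have l1' : |f A - f A'| ≤ L0 * gap (seq B) :=
          l1.trans (mul_le_mul_of_nonneg_left (dA.trans hAB) hL0)
        have l2' : |f B - f B'| ≤ L0 * gap (seq B) :=
          l2.trans (mul_le_mul_of_nonneg_left dB hL0)
        have t1 : dist A B ≤ dist A A' + dist A' B' + dist B B' := by
          have := dist_triangle4 A A' B' B
          rwa [dist_comm B' B] at this
        have t2 : |f A' - f B'| ≤ |f A - f B| + 2 * (L0 * gap (seq B)) := by
          have := abs_le.1 l1'
          have := abs_le.1 l2'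
          have := abs_le.1 (le_refl |f A - f B|)
          rw [abs_le]; constructor <;> linarith
        have t3 := mul_le_mul_of_nonneg_left t2 hC0
        have t4 : dist A B ≤ 2 * C0 * |f A - f B| := by
          rw [hC] at c1
          nlinarith
        have := abs_nonneg (f A - f B)
        nlinarith
      have c1 := not_lt.1 c1
      by_cases c2 : 2 * gap (seq A) < gap (seq B)
      · refine ⟨δ, Or.inl (Or.inr rfl), ?_⟩
        rw [hδE A hA, hδE B hB]
        rw [abs_sub_comm, abs_of_nonneg (by linarith)]
        nlinarith
      have c2 := not_lt.1 c2
      by_cases c3 : gap (seq A) = 0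
      · refine ⟨δ, Or.inl (Or.inr rfl), ?_⟩
        have : gap (seq B) = 0 := by linarith
        rw [this, mul_zero] at c1
        exact c1.trans (by positivity)
      obtain ⟨j0, hj0⟩ := exists_mem_Ico_zpow (lt_of_le_of_ne gA (Ne.symm c3)) (one_lt_two)
      obtain ⟨j, p, hp⟩ : ∃ (j : ℤ) (p : Fin 3), j0 = 3 * j + p.1 :=
        ⟨j0 / 3, ⟨(j0 % 3).toNat, by omega⟩, by simp only; omega⟩
      rw [hp] at hj0
      have e1 : (2 : ℝ) ^ (3 * j + (p.1 : ℤ) + 1) = 2 ^ (3 * j + (p.1 : ℤ)) * 2 :=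
        zpow_add_one₀ (by norm_num) _
      have e2 : (2 : ℝ) ^ (3 * j + (p.1 : ℤ) + 2) = 2 ^ (3 * j + (p.1 : ℤ)) * 4 := by
        rw [zpow_add₀ (by norm_num)]; norm_num
      have s0 : (0 : ℝ) < 2 ^ (3 * j + (p.1 : ℤ)) := by positivity
      have a1 := hj0.1
      have a2 := hj0.2
      rw [e1] at a2
      have EA := fun i => hΦE p i A hA j a1 (by rw [e2]; linarith)
      have EB := fun i => hΦE p i B hB j (a1.trans hAB) (by rw [e2]; linarith)
      set s : ℝ := 2 ^ (3 * j + (p.1 : ℤ)) with hs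
      have hdR : dist A B ≤ R * s := by nlinarith
      have si := inv_pos.2 s0
      have hdR' : s⁻¹ * dist A B ≤ R := by
        rw [inv_mul_le_iff₀ s0]; linarith
      have sc : ∀ (a b : Fin (n + 2) → ℝ) k l r, |a k - b l| ≤ r →
          |(s⁻¹ • a) k - (s⁻¹ • b) l| ≤ s⁻¹ * r := by
        intro a b k l r h
        simp only [Pi.smul_apply, smul_eq_mul]
        rw [← mul_sub, abs_mul, abs_of_pos si]
        exact mul_le_mul_of_nonneg_left h si.le
      obtain ⟨i, hi⟩ := H_sep (n := n) hR (a := s⁻¹ • seq A) (b := s⁻¹ • seq B)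
        (fun k l h => mul_le_mul_of_nonneg_left ((hseq A hA).1 h) si.le) (fun k l h => mul_le_mul_of_nonneg_left ((hseq B hB).1 h) si.le)
        (fun k => by
          obtain ⟨l, hl⟩ := (hseq A hA).close (hseq B hB) k
          exact ⟨l, (sc _ _ _ _ _ hl).trans hdR'⟩)
        (fun k => by
          obtain ⟨l, hl⟩ := (hseq B hB).close (hseq A hA) k
          rw [dist_comm] at hl
          exact ⟨l, (sc _ _ _ _ _ hl).trans hdR'⟩)
      refine ⟨Φ p i, Or.inr ⟨(p, i), rfl⟩, ?_⟩
      rw [EA i, EB i, ← mul_sub, abs_mul, abs_of_pos s0]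
      set X : ℝ := |H R i (s⁻¹ • seq A) - H R i (s⁻¹ • seq B)| with hX
      have hX0 : 0 ≤ X := abs_nonneg _
      have hsX : 0 ≤ s * X := by positivity
      have hDX : 0 ≤ D * (s * X) := by positivity
      have fin : dist A B ≤ R * (D * (s * X)) := by
        rcases hi with hi | hi
        · calc dist A B ≤ R * s * 1 := by linarith
            _ ≤ R * s * (D * X) := mul_le_mul_of_nonneg_left hi (by positivity)
            _ = _ := by ring
        · have : ∀ k, |seq A k - seq B k| ≤ D * (s * X) := by
            intro k
            have := hi k
            simp only [Pi.smul_apply, smul_eq_mul] at this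
            rw [← mul_sub, abs_mul, abs_of_pos si, inv_mul_le_iff₀ s0] at this
            linarith
          have : dist A B ≤ D * (s * X) :=
            (hseq A hA).dist_le (hseq B hB) _ hDX (fun k => ⟨k, this k⟩)
              (fun k => ⟨k, by rw [abs_sub_comm]; exact this k⟩)
          nlinarith
      have q1 : 0 ≤ C0 * (s * X) := by positivity
      have q2 : 0 ≤ C * (s * X) := by positivity
      linarith
    intro A B hA hB
    rcases le_total (gap (seq A)) (gap (seq B)) with h | h
    · exact main A hA B hB h
    · obtain ⟨f, hf, h'⟩ := main B hB A hA h
      exact ⟨f, hf, by rwa [dist_comm, abs_sub_comm]⟩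

theorem good (n : ℕ) (hn : 1 ≤ n) : Good n := by
  induction n, hn using Nat.le_induction with
  | base => exact good_one
  | succ n hn ih =>
    obtain ⟨m, rfl⟩ : ∃ m, n = m + 1 := ⟨n - 1, by omega⟩
    exact good_step m ih

/-- Moment curve functionals. -/
noncomputable def lin {m : ℕ} (t : ℕ) (v : EuclideanSpace ℝ (Fin m)) : ℝ :=
  ∑ i : Fin m, v i * (t : ℝ) ^ (i : ℕ)

theorem lin_sub {m : ℕ} (t : ℕ) (v w : EuclideanSpace ℝ (Fin m)) :
    lin t (v - w) = lin t v - lin t w := by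
  simp [lin, sub_mul, Finset.sum_sub_distrib]

theorem lin_bdd {m : ℕ} (t : ℕ) : ∃ M : ℝ, 0 ≤ M ∧ ∀ v : EuclideanSpace ℝ (Fin m),
    |lin t v| ≤ M * ‖v‖ := by
  refine ⟨∑ i : Fin m, (t : ℝ) ^ (i : ℕ), by positivity, fun v => ?_⟩
  unfold lin
  refine (Finset.abs_sum_le_sum_abs _ _).trans ?_
  rw [Finset.sum_mul]
  refine Finset.sum_le_sum fun i _ => ?_
  rw [abs_mul, abs_of_nonneg (by positivity : (0 : ℝ) ≤ (t : ℝ) ^ (i : ℕ)), mul_comm]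
  exact mul_le_mul_of_nonneg_left (PiLp.norm_apply_le v i) (by positivity)

theorem dirs_one {m N : ℕ} (s : Fin m → Fin N) : ∃ K : ℝ, Function.Injective s →
    ∀ (v : EuclideanSpace ℝ (Fin m)) (c : ℝ), 0 ≤ c → (∀ k, |lin (s k).1 v| ≤ c) →
      ‖v‖ ≤ K * c := by
  by_cases hs : Function.Injective s
  swap
  · exact ⟨0, fun h => absurd h hs⟩
  let M : EuclideanSpace ℝ (Fin m) →ₗ[ℝ] (Fin m → ℝ) :=
    { toFun := fun v k => lin (s k).1 v
      map_add' := fun v w => by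
        ext k; simp [lin, add_mul, Finset.sum_add_distrib]
      map_smul' := fun r v => by
        ext k; simp [lin, Finset.mul_sum, mul_assoc] }
  have hM : LinearMap.ker M = ⊥ := by
    rw [LinearMap.ker_eq_bot']
    intro v hv
    have := Matrix.eq_zero_of_forall_index_sum_mul_pow_eq_zero
      (f := fun k : Fin m => ((s k).1 : ℝ)) (v := fun i => v i)
      (fun x y h => hs (Fin.ext (by simpa using h))) (fun j => congrFun hv j)
    ext i
    exact congrFun this i
  obtain ⟨K, _, hK⟩ := M.exists_antilipschitzWith hM
  refine ⟨K, fun _ v c hc hv => ?_⟩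
  have h1 := hK.le_mul_dist v 0
  rw [map_zero, dist_zero_right, dist_zero_right] at h1
  refine h1.trans (mul_le_mul_of_nonneg_left ?_ K.2)
  exact (pi_norm_le_iff_of_nonneg hc).2 fun k => hv k

theorem dirs (m N : ℕ) : ∃ c : ℝ, 0 < c ∧ ∀ v : EuclideanSpace ℝ (Fin m),
    (Finset.univ.filter fun t : Fin N => |lin t.1 v| < c * ‖v‖).card ≤ m := by
  choose K hK using fun s : Fin m → Fin N => dirs_one s
  obtain ⟨K0, hK0⟩ := (Set.finite_range K).bddAbove
  set K1 : ℝ := max K0 0 with hK1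
  have hK1' : 0 ≤ K1 := le_max_right _ _
  refine ⟨1 / (2 * (K1 + 1)), by positivity, fun v => ?_⟩
  by_contra hc
  have hc0 := not_le.1 hc
  have hc := hc0.le
  set T := Finset.univ.filter fun t : Fin N => |lin t.1 v| < 1 / (2 * (K1 + 1)) * ‖v‖ with hT
  by_cases hv : v = 0
  · have : T = ∅ := by
      rw [hT, hv]; simp
    rw [this] at hc0
    simp at hc0
  have hv : 0 < ‖v‖ := norm_pos_iff.2 hv
  let e : Fin m → Fin N := T.orderEmbOfCardLe hc
  have he : Function.Injective e := (T.orderEmbOfCardLe hc).injective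
  have h1 := hK e he v (1 / (2 * (K1 + 1)) * ‖v‖) (by positivity) (fun k => by
    have : e k ∈ T := Finset.orderEmbOfCardLe_mem T hc k
    rw [hT, Finset.mem_filter] at this
    exact this.2.le)
  have h2 : K e ≤ K1 := (hK0 ⟨e, rfl⟩).trans (le_max_left _ _)
  have h3 : ‖v‖ ≤ K1 * (1 / (2 * (K1 + 1)) * ‖v‖) :=
    h1.trans (mul_le_mul_of_nonneg_right h2 (by positivity))
  have h4 : K1 * (1 / (2 * (K1 + 1)) * ‖v‖) = K1 / (K1 + 1) * (‖v‖ / 2) := by field_simp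
  have h5 : K1 / (K1 + 1) ≤ 1 := (div_le_one (by linarith)).2 (by linarith)
  nlinarith

theorem exists_rep {n : ℕ} (K : NonemptyCompacts ℝ) (hf : (K : Set ℝ).Finite)
    (hn : (K : Set ℝ).ncard ≤ n) : ∃ a, Rep n K a := by
  classical
  have hc : hf.toFinset.card ≤ n := by rwa [← Set.ncard_eq_toFinset_card _ hf]
  have hpos : 0 < hf.toFinset.card := by
    rw [Finset.card_pos]; simpa using K.nonempty
  set c := hf.toFinset.card with hcdef
  let e := hf.toFinset.orderEmbOfFin hcdef.symm
  refine ⟨fun i => e ⟨min i.1 (c - 1), by omega⟩, ?_, ?_⟩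
  · intro i j hij
    apply e.monotone
    have : i.1 ≤ j.1 := hij
    simp only [Fin.mk_le_mk]; omega
  · ext x
    constructor
    · rintro ⟨i, rfl⟩
      have := hf.toFinset.orderEmbOfFin_mem hcdef.symm ⟨min i.1 (c - 1), by omega⟩
      exact hf.mem_toFinset.1 this
    · intro hx
      have : x ∈ Set.range e := by
        rw [Finset.range_orderEmbOfFin]; simpa using hx
      obtain ⟨k, rfl⟩ := this
      refine ⟨⟨k.1, by omega⟩, ?_⟩
      have : (⟨min k.1 (c - 1), by omega⟩ : Fin c) = k := Fin.ext (by simp only; omega)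
      exact congrArg e this

theorem forward (X : Type*) [MetricSpace X] (n : ℕ) (hn : 1 ≤ n) (m : ℕ) (L : ℝ)
    (f : X → EuclideanSpace ℝ (Fin m)) (hL : 1 ≤ L)
    (h : ∀ x y : X, L⁻¹ * dist x y ≤ ‖f x - f y‖ ∧ ‖f x - f y‖ ≤ L * dist x y) :
    ∃ (ι : Type) (_ : Fintype ι)
      (G : ι → {A : Set X // A.Finite ∧ A.Nonempty ∧ A.ncard ≤ n} → ℝ) (M : ℝ),
      0 ≤ M ∧ (∀ i A B, |G i A - G i B| ≤ M * hausdorffDist A.1 B.1) ∧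
      ∀ A B, ∃ i, hausdorffDist A.1 B.1 ≤ M * |G i A - G i B| := by
  classical
  obtain ⟨F, hF, hFL, C, hC, hsep⟩ := good n hn
  obtain ⟨L0, hL0, hLip⟩ := unif hF hFL
  set N : ℕ := m * (n * n) + 1 with hN
  obtain ⟨c, hc, hdir⟩ := dirs m N
  choose M hM0 hM using fun t : Fin N => lin_bdd (m := m) t.1
  have hL0' : 0 < L := by linarith
  let u : Fin N → X → ℝ := fun t x => lin t.1 (f x)
  let Kt : Fin N → {A : Set X // A.Finite ∧ A.Nonempty ∧ A.ncard ≤ n} → NonemptyCompacts ℝ :=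
    fun t A => ⟨⟨u t '' A.1, (A.2.1.image _).isCompact⟩, A.2.2.1.image _⟩
  have hKfin : ∀ t A, ((Kt t A : NonemptyCompacts ℝ) : Set ℝ).Finite := fun t A => A.2.1.image _
  have hrep : ∀ t A, ∃ a, Rep n (Kt t A) a := fun t A =>
    exists_rep _ (hKfin t A) ((Set.ncard_image_le A.2.1).trans A.2.2.2)
  have hu : ∀ t x y, |u t x - u t y| ≤ M t * L * dist x y := by
    intro t x y
    simp only [u]
    rw [← lin_sub]
    refine (hM t _).trans ?_
    rw [mul_assoc]
    exact mul_le_mul_of_nonneg_left (h x y).2 (hM0 t)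
  have hK1 : ∀ t A B, dist (Kt t A) (Kt t B) ≤ M t * L * hausdorffDist A.1 B.1 := by
    intro t A B
    have hML : 0 ≤ M t * L := mul_nonneg (hM0 t) hL0'.le
    have key : ∀ A B : {A : Set X // A.Finite ∧ A.Nonempty ∧ A.ncard ≤ n},
        ∀ x ∈ u t '' A.1, ∃ y ∈ u t '' B.1, dist x y ≤ M t * L * hausdorffDist A.1 B.1 := by
      rintro A B _ ⟨x, hx, rfl⟩
      obtain ⟨y, hy, hxy⟩ := haus_exists A.2.1 B.2.1 A.2.2.1 B.2.2.1 hx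
      exact ⟨_, ⟨y, hy, rfl⟩, (hu t x y).trans (mul_le_mul_of_nonneg_left hxy hML)⟩
    rw [NonemptyCompacts.dist_eq]
    apply hausdorffDist_le_of_mem_dist (mul_nonneg hML hausdorffDist_nonneg) (key A B)
    rw [hausdorffDist_comm]
    exact key B A
  have hK2 : ∀ A B, ∃ t, hausdorffDist A.1 B.1 ≤ L / c * dist (Kt t A) (Kt t B) := by
    intro A B
    let bad : X × X → Finset (Fin N) := fun q =>
      Finset.univ.filter fun t : Fin N => |lin t.1 (f q.1 - f q.2)| < c * ‖f q.1 - f q.2‖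
    let P : Finset (X × X) := A.2.1.toFinset ×ˢ B.2.1.toFinset
    have hP : P.card ≤ n * n := by
      rw [Finset.card_product, ← Set.ncard_eq_toFinset_card _ A.2.1,
        ← Set.ncard_eq_toFinset_card _ B.2.1]
      exact Nat.mul_le_mul A.2.2.2 B.2.2.2
    have hbad : (P.biUnion bad).card < N := by
      have h1 := Finset.card_biUnion_le_card_mul P bad m (fun q _ => hdir _)
      have h2 : P.card * m ≤ m * (n * n) := by
        rw [mul_comm]; exact Nat.mul_le_mul_left _ hP
      omega
    obtain ⟨t, ht⟩ : ∃ t, t ∉ P.biUnion bad := by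
      by_contra hcon
      push Not at hcon
      rw [Finset.eq_univ_iff_forall.2 hcon, Finset.card_univ, Fintype.card_fin] at hbad
      exact lt_irrefl _ hbad
    have hgood : ∀ x ∈ A.1, ∀ y ∈ B.1, dist x y ≤ L / c * |u t x - u t y| := by
      intro x hx y hy
      have h1 : c * ‖f x - f y‖ ≤ |lin t.1 (f x - f y)| := by
        by_contra hcon
        apply ht
        rw [Finset.mem_biUnion]
        refine ⟨(x, y), ?_, ?_⟩
        · simp [P, hx, hy]
        · simpa [bad] using hcon
      rw [lin_sub] at h1
      have h2 := (h x y).1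
      rw [inv_mul_le_iff₀ hL0'] at h2
      have h3 : ‖f x - f y‖ ≤ |u t x - u t y| / c := by
        rw [le_div_iff₀ hc]; linarith
      calc dist x y ≤ L * (|u t x - u t y| / c) := h2.trans (mul_le_mul_of_nonneg_left h3 hL0'.le)
        _ = _ := by ring
    refine ⟨t, ?_⟩
    have hLc : 0 ≤ L / c := by positivity
    apply hausdorffDist_le_of_mem_dist (mul_nonneg hLc dist_nonneg)
    · intro x hx
      obtain ⟨_, ⟨y, hy, rfl⟩, hxy⟩ := haus_exists (hKfin t A) (hKfin t B) (Kt t A).nonempty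
        (Kt t B).nonempty (x := u t x) ⟨x, hx, rfl⟩
      exact ⟨y, hy, (hgood x hx y hy).trans (mul_le_mul_of_nonneg_left hxy hLc)⟩
    · intro y hy
      obtain ⟨_, ⟨x, hx, rfl⟩, hxy⟩ := haus_exists (hKfin t B) (hKfin t A) (Kt t B).nonempty
        (Kt t A).nonempty (x := u t y) ⟨y, hy, rfl⟩
      refine ⟨x, hx, ?_⟩
      rw [dist_comm]
      refine (hgood x hx y hy).trans (mul_le_mul_of_nonneg_left ?_ hLc)
      rw [dist_comm (Kt t A), abs_sub_comm]
      exact hxy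
  obtain ⟨M1, hM1⟩ := (Set.finite_range M).bddAbove
  set M2 := max M1 0 with hM2
  have hM2' : 0 ≤ M2 := le_max_right _ _
  have hMM : ∀ t, M t ≤ M2 := fun t => (hM1 ⟨t, rfl⟩).trans (le_max_left _ _)
  -- a finite index type in `Type`
  have hfin : Finite F := hF
  obtain ⟨q, ⟨e⟩⟩ := Finite.exists_equiv_fin F
  have w1 : 0 ≤ L0 * (M2 * L) := by positivity
  have w2 : 0 ≤ L / c * C := by positivity
  refine ⟨Fin N × Fin q, inferInstance, fun p A => (e.symm p.2).1 (Kt p.1 A),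
    L0 * (M2 * L) + L / c * C, by positivity, ?_, ?_⟩
  · intro p A B
    have hd : 0 ≤ hausdorffDist A.1 B.1 := hausdorffDist_nonneg
    refine (hLip _ (e.symm p.2).2 _ _).trans ?_
    have h1 : dist (Kt p.1 A) (Kt p.1 B) ≤ M2 * L * hausdorffDist A.1 B.1 := by
      refine (hK1 _ _ _).trans ?_
      have := hMM p.1
      gcongr
    have h2 := mul_le_mul_of_nonneg_left h1 hL0
    have h3 := mul_nonneg w2 hd
    linarith
  · intro A B
    obtain ⟨t, ht⟩ := hK2 A B
    obtain ⟨g, hg, hgs⟩ := hsep _ _ (hrep t A) (hrep t B)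
    refine ⟨(t, e ⟨g, hg⟩), ?_⟩
    simp only [Equiv.symm_apply_apply]
    have h1 := mul_le_mul_of_nonneg_left hgs (by positivity : 0 ≤ L / c)
    have h3 := mul_nonneg w1 (abs_nonneg (g (Kt t A) - g (Kt t B)))
    linarith

theorem norm_le_sum {N : ℕ} (v : EuclideanSpace ℝ (Fin N)) (r : ℝ) (hr : 0 ≤ r)
    (h : ∀ i, |v i| ≤ r) : ‖v‖ ≤ N * r := by
  rw [EuclideanSpace.norm_eq]
  apply Real.sqrt_le_iff.2 ⟨by positivity, ?_⟩
  have h1 : ∑ i, ‖v i‖ ^ 2 ≤ ∑ _i : Fin N, r ^ 2 :=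
    Finset.sum_le_sum fun i _ => pow_le_pow_left₀ (norm_nonneg _) (h i) 2
  simp only [Finset.sum_const, Finset.card_univ, Fintype.card_fin, nsmul_eq_mul] at h1
  refine h1.trans ?_
  rw [mul_pow]
  apply mul_le_mul_of_nonneg_right _ (sq_nonneg r)
  have : N ≤ N ^ 2 := Nat.le_self_pow two_ne_zero N
  exact_mod_cast this

end SymProd


/-- **Corollary (Kovalev).** A metric space `X` admits a bi-Lipschitz embedding into some
Euclidean space if and only if its `n`-th symmetric product does. -/
theorem symmetric_product_biLipschitz_embeddable_iff (X : Type*) [MetricSpace X]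
    (n : ℕ) (hn : 1 ≤ n) :
    (∃ (m : ℕ) (L : ℝ) (f : X → EuclideanSpace ℝ (Fin m)), 1 ≤ L ∧
        ∀ x y : X, L⁻¹ * dist x y ≤ ‖f x - f y‖ ∧ ‖f x - f y‖ ≤ L * dist x y) ↔
    (∃ (m' : ℕ) (L : ℝ)
        (g : {A : Set X // A.Finite ∧ A.Nonempty ∧ A.ncard ≤ n} → EuclideanSpace ℝ (Fin m')),
        1 ≤ L ∧ ∀ A B : {A : Set X // A.Finite ∧ A.Nonempty ∧ A.ncard ≤ n},
          L⁻¹ * hausdorffDist A.1 B.1 ≤ ‖g A - g B‖ ∧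
          ‖g A - g B‖ ≤ L * hausdorffDist A.1 B.1) := by
  constructor
  · rintro ⟨m, L, f, hL, h⟩
    obtain ⟨ι, hι, G, M, hM, h1, h2⟩ := SymProd.forward X n hn m L f hL h
    let e := Fintype.equivFin ι
    set N := Fintype.card ι with hN
    set L' : ℝ := 1 + M + N * M with hL'
    have hNM : 0 ≤ N * M := by positivity
    have hL1 : 1 ≤ L' := by linarith
    refine ⟨N, L', fun A => WithLp.toLp 2 fun k => G (e.symm k) A, hL1, ?_⟩
    intro A B
    have hd : 0 ≤ hausdorffDist A.1 B.1 := hausdorffDist_nonneg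
    constructor
    · obtain ⟨i, hi⟩ := h2 A B
      rw [inv_mul_le_iff₀ (by linarith)]
      set v : EuclideanSpace ℝ (Fin N) := (WithLp.toLp 2 fun k => G (e.symm k) A) -
        WithLp.toLp 2 fun k => G (e.symm k) B with hv
      have h3 : |G i A - G i B| ≤ ‖v‖ := by
        have := PiLp.norm_apply_le v (e i)
        simpa [hv] using this
      have h4 := norm_nonneg v
      have h5 := mul_le_mul_of_nonneg_left h3 hM
      have h6 := mul_nonneg hNM h4
      rw [hL']
      linarith
    · refine (SymProd.norm_le_sum _ (M * hausdorffDist A.1 B.1) (by positivity) ?_).trans ?_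
      · intro k
        simpa using h1 (e.symm k) A B
      · have := mul_nonneg hM hd
        rw [hL']
        linarith
  · rintro ⟨m, L, g, hL, h⟩
    refine ⟨m, L, fun x => g ⟨{x}, Set.finite_singleton x, Set.singleton_nonempty x, by
      rw [Set.ncard_singleton]; exact hn⟩, hL, fun x y => ?_⟩
    have := h ⟨{x}, Set.finite_singleton x, Set.singleton_nonempty x, by
      rw [Set.ncard_singleton]; exact hn⟩ ⟨{y}, Set.finite_singleton y,
      Set.singleton_nonempty y, by rw [Set.ncard_singleton]; exact hn⟩
    simpa only [hausdorffDist_singleton] using this
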